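/- Let n ≥ 3 and F ⊆ E(Q_n) with |F| ≤ 2n − 5. If every vertex of Q_n − F has degree at least 2, then Q_n − F contains a Hamiltonian cycle. -/

import Mathlib

open SimpleGraph Finset
open scoped Classical

/-- The `n`-dimensional hypercube graph: vertices are `Fin n → Bool`,
adjacent iff they differ in exactly one coordinate. -/
def Q (n : ℕ) : SimpleGraph (Fin n → Bool) :=
  SimpleGraph.fromRel fun x y => (Finset.univ.filter fun i => x i ≠ y i).card = 1

/-- Parity of a vertex of the hypercube: sum of coordinates mod 2. -/
def qparity {n : ℕ} (x : Fin n → Bool) : ZMod 2 :=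
  ∑ i, if x i then 1 else 0

/-- Degree of a vertex after deleting the faulty edges. -/
noncomputable def faultyDeg {n : ℕ} (F : Finset (Sym2 (Fin n → Bool)))
    (v : Fin n → Bool) : ℕ :=
  (((Q n).deleteEdges ↑F).neighborSet v).ncard

/-- The vertex obtained from `x` by flipping coordinate `i`. -/
def flipAt {n : ℕ} (i : Fin n) (x : Fin n → Bool) : Fin n → Bool :=
  Function.update x i (!x i)

/-- `x` lies in the subcube through `c` with free coordinates `S`. -/
def InCube {n : ℕ} (S : Finset (Fin n)) (c x : Fin n → Bool) : Prop :=
  ∀ i ∉ S, x i = c i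

/-- Adjacency in the hypercube through an edge outside `F`. -/
def Healthy {n : ℕ} (F : Finset (Sym2 (Fin n → Bool))) (x y : Fin n → Bool) : Prop :=
  (∃ i, y = flipAt i x) ∧ s(x, y) ∉ F

/-- The faulty edges inside the subcube through `c` with free coordinates `S`. -/
noncomputable def cubeFaults {n : ℕ} (S : Finset (Fin n)) (c : Fin n → Bool)
    (F : Finset (Sym2 (Fin n → Bool))) : Finset (Sym2 (Fin n → Bool)) :=
  {e ∈ F | ∃ x i, InCube S c x ∧ i ∈ S ∧ e = s(x, flipAt i x)}

/-- The faulty edges in direction `d` at the vertices of the subcube through `c` with free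
coordinates `S`. -/
noncomputable def crossFaults {n : ℕ} (S : Finset (Fin n)) (d : Fin n) (c : Fin n → Bool)
    (F : Finset (Sym2 (Fin n → Bool))) : Finset (Sym2 (Fin n → Bool)) :=
  {e ∈ F | ∃ x, InCube S c x ∧ e = s(x, flipAt d x)}

/-- The directions in `S` of the faulty edges at `x`. -/
noncomputable def faultyDirs {n : ℕ} (S : Finset (Fin n)) (F : Finset (Sym2 (Fin n → Bool)))
    (x : Fin n → Bool) : Finset (Fin n) :=
  {i ∈ S | s(x, flipAt i x) ∈ F}

/-- `l` lists the vertices of a Hamiltonian path from `u` to `v`, avoiding `F`, of the subcube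
through `c` with free coordinates `S`. -/
structure IsHamPath {n : ℕ} (S : Finset (Fin n)) (c : Fin n → Bool)
    (F : Finset (Sym2 (Fin n → Bool))) (u v : Fin n → Bool) (l : List (Fin n → Bool)) : Prop where
  chain : l.IsChain (Healthy F)
  nodup : l.Nodup
  mem : ∀ x, x ∈ l ↔ InCube S c x
  len : l.length = 2 ^ S.card
  head : l.head? = some u
  last : l.getLast? = some v

/-- `l` lists the vertices of a Hamiltonian cycle, avoiding `F`, of the subcube through `c` with
free coordinates `S`. -/
structure IsHamCycle {n : ℕ} (S : Finset (Fin n)) (c : Fin n → Bool)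
    (F : Finset (Sym2 (Fin n → Bool))) (l : List (Fin n → Bool)) : Prop where
  chain : l.IsChain (Healthy F)
  nodup : l.Nodup
  mem : ∀ x, x ∈ l ↔ InCube S c x
  len : l.length = 2 ^ S.card
  close : ∀ x ∈ l.getLast?, ∀ y ∈ l.head?, Healthy F x y

section

variable {n : ℕ} {S : Finset (Fin n)} {F F' : Finset (Sym2 (Fin n → Bool))}
  {c u v x y : Fin n → Bool} {d i j : Fin n} {l : List (Fin n → Bool)}

@[simp] lemma flipAt_flipAt (i : Fin n) (x : Fin n → Bool) : flipAt i (flipAt i x) = x := by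
  simp [flipAt]

lemma flipAt_apply_self (i : Fin n) (x : Fin n → Bool) : flipAt i x i = !x i := by
  simp [flipAt]

lemma flipAt_apply_of_ne (h : j ≠ i) (x : Fin n → Bool) : flipAt i x j = x j := by
  simp [flipAt, h]

lemma flipAt_ne (i : Fin n) (x : Fin n → Bool) : flipAt i x ≠ x := fun h => by
  have := congrFun h i
  simp [flipAt_apply_self] at this

lemma flipAt_left_injective (x : Fin n → Bool) : Function.Injective (flipAt · x) := by
  intro i j h
  by_contra hij
  have := congrFun h i
  simp [flipAt_apply_self, flipAt_apply_of_ne hij] at this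

lemma qparity_flipAt (i : Fin n) (x : Fin n → Bool) : qparity (flipAt i x) = qparity x + 1 := by
  unfold qparity
  rw [← Finset.add_sum_erase _ _ (mem_univ i),
    ← Finset.add_sum_erase (a := i) univ (fun j => if x j then (1 : ZMod 2) else 0) (mem_univ i),
    Finset.sum_congr rfl (g := fun j => if x j then (1 : ZMod 2) else 0)
      fun j hj => by rw [flipAt_apply_of_ne (Finset.ne_of_mem_erase hj)], flipAt_apply_self]
  generalize ∑ j ∈ univ.erase i, (if x j then (1 : ZMod 2) else 0) = t
  cases x i <;> revert t <;> decide

lemma edge_eq_iff :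
    s(x, flipAt i x) = s(y, flipAt j y) ↔ i = j ∧ (x = y ∨ x = flipAt i y) := by
  constructor
  · intro h
    rcases Sym2.eq_iff.1 h with ⟨rfl, h⟩ | ⟨rfl, h⟩
    · exact ⟨flipAt_left_injective _ h, .inl rfl⟩
    · have : flipAt i (flipAt i (flipAt j y)) = flipAt i y := congrArg _ h
      rw [flipAt_flipAt] at this
      obtain rfl := flipAt_left_injective _ this
      exact ⟨rfl, .inr rfl⟩
  · rintro ⟨rfl, rfl | rfl⟩
    · rfl
    · rw [flipAt_flipAt, Sym2.eq_swap]

lemma edge_flipAt (i : Fin n) (x : Fin n → Bool) :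
    s(flipAt i x, flipAt i (flipAt i x)) = s(x, flipAt i x) := by
  rw [flipAt_flipAt, Sym2.eq_swap]

lemma Healthy.symm (h : Healthy F x y) : Healthy F y x := by
  obtain ⟨⟨i, rfl⟩, h⟩ := h
  exact ⟨⟨i, by simp⟩, by rwa [Sym2.eq_swap]⟩

lemma Healthy.qparity_eq (h : Healthy F x y) : qparity y = qparity x + 1 := by
  obtain ⟨⟨i, rfl⟩, -⟩ := h
  exact qparity_flipAt i x

lemma inCube_self : InCube S c c := fun _ _ => rfl

lemma InCube.symm (h : InCube S c x) : InCube S x c := fun i hi => (h i hi).symm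

lemma InCube.trans (h : InCube S c x) (h' : InCube S x y) : InCube S c y :=
  fun i hi => (h' i hi).trans (h i hi)

lemma InCube.flipAt (h : InCube S c x) (hi : i ∈ S) : InCube S c (flipAt i x) := fun j hj => by
  rw [flipAt_apply_of_ne (by rintro rfl; exact hj hi), h j hj]

lemma inCube_iff (hd : d ∈ S) :
    InCube S c x ↔ InCube (S.erase d) c x ∨ InCube (S.erase d) (flipAt d c) x := by
  constructor
  · intro h
    by_cases hx : x d = c d
    · left
      intro i hi
      by_cases hid : i = d
      · rw [hid, hx]
      · exact h i fun h => hi (mem_erase.2 ⟨hid, h⟩)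
    · right
      intro i hi
      by_cases hid : i = d
      · rw [hid, flipAt_apply_self]; revert hx; cases x d <;> cases c d <;> simp
      · rw [flipAt_apply_of_ne hid]; exact h i fun h => hi (mem_erase.2 ⟨hid, h⟩)
  · rintro (h | h) i hi
    · exact h i fun h => hi (mem_of_mem_erase h)
    · rw [h i fun h => hi (mem_of_mem_erase h), flipAt_apply_of_ne (by rintro rfl; exact hi hd)]

lemma not_inCube_both (h : InCube (S.erase d) c x) : ¬ InCube (S.erase d) (flipAt d c) x := by
  intro h'
  have h1 := h d (notMem_erase d S)
  have h2 := h' d (notMem_erase d S)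
  rw [h1, flipAt_apply_self] at h2
  simp at h2

lemma InCube.flipAt_base (h : InCube (S.erase d) c x) :
    InCube (S.erase d) (_root_.flipAt d c) (_root_.flipAt d x) := fun i hi => by
  by_cases hid : i = d
  · rw [hid, flipAt_apply_self, flipAt_apply_self, h d (notMem_erase d S)]
  · rw [flipAt_apply_of_ne hid, flipAt_apply_of_ne hid, h i hi]

lemma mem_of_inCube_flipAt (h : InCube S c x) (h' : InCube S c (flipAt i x)) : i ∈ S := by
  by_contra hi
  have := h' i hi
  rw [flipAt_apply_self, h i hi] at this
  simp at this

lemma cubeFaults_subset : cubeFaults S c F ⊆ F := filter_subset _ _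

lemma Healthy.of_cubeFaults (hF : cubeFaults S c F ⊆ F') (hx : InCube S c x) (hy : InCube S c y)
    (h : Healthy F' x y) : Healthy F x y := by
  obtain ⟨⟨i, rfl⟩, h⟩ := h
  exact ⟨⟨i, rfl⟩, fun he => h <| hF <|
    mem_filter.2 ⟨he, x, i, hx, mem_of_inCube_flipAt hx hy, rfl⟩⟩

lemma IsHamPath.of_cubeFaults (h : IsHamPath S c F' u v l) (hF : cubeFaults S c F ⊆ F') :
    IsHamPath S c F u v l where
  __ := h
  chain := h.chain.imp_of_mem_imp fun _ _ hx hy h' =>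
    h'.of_cubeFaults hF ((h.mem _).1 hx) ((h.mem _).1 hy)

lemma IsHamCycle.of_cubeFaults (h : IsHamCycle S c F' l) (hF : cubeFaults S c F ⊆ F') :
    IsHamCycle S c F l where
  __ := h
  chain := h.chain.imp_of_mem_imp fun _ _ hx hy h' =>
    h'.of_cubeFaults hF ((h.mem _).1 hx) ((h.mem _).1 hy)
  close := fun x hx y hy => (h.close x hx y hy).of_cubeFaults hF
    ((h.mem _).1 (List.mem_of_getLast? hx)) ((h.mem _).1 (List.mem_of_head? hy))

lemma cubeFaults_erase_subset (hd : d ∈ S) : cubeFaults (S.erase d) c F ⊆ cubeFaults S c F := by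
  intro e he
  obtain ⟨heF, x, i, hx, hi, rfl⟩ := mem_filter.1 he
  exact mem_filter.2 ⟨heF, x, i, (inCube_iff hd).2 (.inl hx), mem_of_mem_erase hi, rfl⟩

lemma cubeFaults_congr (h : InCube S c x) : cubeFaults S x F = cubeFaults S c F :=
  filter_congr fun _ _ => ⟨fun ⟨y, i, hy, h'⟩ => ⟨y, i, h.trans hy, h'⟩,
    fun ⟨y, i, hy, h'⟩ => ⟨y, i, h.symm.trans hy, h'⟩⟩

lemma card_faults_add_le (S : Finset (Fin n)) (d : Fin n) (c : Fin n → Bool)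
    (F : Finset (Sym2 (Fin n → Bool))) :
    (cubeFaults (S.erase d) c F).card + (cubeFaults (S.erase d) (flipAt d c) F).card +
      (crossFaults (S.erase d) d c F).card ≤ F.card := by
  have h1 : Disjoint (cubeFaults (S.erase d) c F) (cubeFaults (S.erase d) (flipAt d c) F) := by
    refine Finset.disjoint_left.2 fun e he he' => ?_
    obtain ⟨-, x, i, hx, hi, rfl⟩ := mem_filter.1 he
    obtain ⟨-, y, j, hy, hj, h⟩ := mem_filter.1 he'
    obtain ⟨rfl, rfl | rfl⟩ := edge_eq_iff.1 h
    · exact not_inCube_both hx hy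
    · exact not_inCube_both hx (hy.flipAt hi)
  have h2 : Disjoint (cubeFaults (S.erase d) c F ∪ cubeFaults (S.erase d) (flipAt d c) F)
      (crossFaults (S.erase d) d c F) := by
    refine Finset.disjoint_left.2 fun e he he' => ?_
    obtain ⟨-, y, hy, rfl⟩ := mem_filter.1 he'
    rcases mem_union.1 he with he | he <;>
    · obtain ⟨-, x, i, hx, hi, h⟩ := mem_filter.1 he
      exact ne_of_mem_erase hi (edge_eq_iff.1 h).1.symm
  rw [← card_union_of_disjoint h1, ← card_union_of_disjoint h2]
  exact card_le_card (union_subset (union_subset (filter_subset _ _) (filter_subset _ _))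
    (filter_subset _ _))

lemma length_le_of_isChain_or {α : Type*} (p : α → Prop) [DecidablePred p] :
    ∀ l : List α, l.IsChain (fun a b => p a ∨ p b) → l.length ≤ 2 * l.countP p + 1
  | [], _ => by simp
  | [a], _ => by simp
  | a :: b :: t, h => by
    by_cases ha : p a
    · have := length_le_of_isChain_or p (b :: t) h.tail
      rw [List.countP_cons_of_pos (by simpa using ha)]
      simp only [List.length_cons] at this ⊢
      omega
    · have hb : p b := (List.isChain_cons_cons.1 h).1.resolve_left ha
      have := length_le_of_isChain_or p t h.tail.tail
      rw [List.countP_cons_of_neg (by simpa using ha), List.countP_cons_of_pos (by simpa using hb)]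
      simp only [List.length_cons]
      omega

lemma exists_append_of_not_isChain {α : Type*} {R : α → α → Prop} {l : List α}
    (h : ¬ l.IsChain R) : ∃ l₁ a b l₂, l = l₁ ++ a :: b :: l₂ ∧ ¬ R a b := by
  rw [List.isChain_iff_forall_rel_of_append_cons_cons] at h
  push Not at h
  obtain ⟨a, b, l₁, l₂, h, hR⟩ := h
  exact ⟨l₁, a, b, l₂, h, hR⟩

/-- A long enough list of distinct vertices of a subcube has two consecutive vertices at which
the edge in direction `d ∉ S` is not faulty. -/
lemma exists_consecutive_healthy (hd : d ∉ S) (hl : l.Nodup) (hmem : ∀ x ∈ l, InCube S c x)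
    (hlen : 2 * (crossFaults S d c F).card + 1 < l.length) :
    ∃ l₁ a b l₂, l = l₁ ++ a :: b :: l₂ ∧ s(a, flipAt d a) ∉ F ∧ s(b, flipAt d b) ∉ F := by
  have hc : l.countP (fun x => s(x, flipAt d x) ∈ F) ≤ (crossFaults S d c F).card := by
    rw [List.countP_eq_length_filter, ← List.toFinset_card_of_nodup (hl.filter _)]
    refine card_le_card_of_injOn (fun x => s(x, flipAt d x)) ?_ ?_
    · intro x hx
      simp only [List.coe_toFinset, List.mem_filter, decide_eq_true_eq, Set.mem_ofPred_eq] at hx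
      exact mem_coe.2 (mem_filter.2 ⟨hx.2, x, hmem x hx.1, rfl⟩)
    · intro x hx y hy h
      simp only [List.coe_toFinset, List.mem_filter, decide_eq_true_eq, Set.mem_ofPred_eq] at hx hy
      obtain ⟨-, rfl | rfl⟩ := edge_eq_iff.1 h
      · rfl
      · exact absurd (mem_of_inCube_flipAt (hmem y hy.1) (hmem _ hx.1)) hd
  have := mt (length_le_of_isChain_or (fun x => s(x, flipAt d x) ∈ F) l) (by omega)
  obtain ⟨l₁, a, b, l₂, h, hab⟩ := exists_append_of_not_isChain this
  exact ⟨l₁, a, b, l₂, h, not_or.1 hab⟩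

lemma two_mul_lt_two_pow_add_one (m : ℕ) : 2 * m < 2 ^ m + 1 := by
  induction m with
  | zero => simp
  | succ m ih =>
    have : 1 ≤ 2 ^ m := Nat.one_le_two_pow
    rcases m with _ | m
    · simp
    · rw [pow_succ] at this ih ⊢; have : 1 ≤ 2 ^ m := Nat.one_le_two_pow
      omega

/-- A subcube of dimension `m + 1` with at most `m - 1` faults is Hamiltonian laceable. -/
theorem exists_isHamPath (m : ℕ) : ∀ (S : Finset (Fin n)) (F : Finset (Sym2 (Fin n → Bool)))
    (u v : Fin n → Bool), S.card = m + 1 → F.card ≤ m - 1 → InCube S u v →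
    qparity u ≠ qparity v → ∃ l, IsHamPath S u F u v l := by
  induction m with
  | zero =>
    intro S F u v hS hF huv hp
    obtain ⟨i, rfl⟩ := card_eq_one.1 hS
    obtain rfl : F = ∅ := by simpa using hF
    obtain rfl : v = flipAt i u := by
      ext j
      by_cases hj : j = i
      · subst hj
        rw [flipAt_apply_self]
        by_contra h
        refine hp (congrArg _ (funext fun k => ?_))
        by_cases hk : k = j
        · subst hk; revert h; cases u k <;> cases v k <;> simp
        · exact (huv k (by simpa using hk)).symm
      · rw [flipAt_apply_of_ne hj, huv j (by simpa using hj)]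
    refine ⟨[u, flipAt i u], ⟨by simpa [Healthy] using ⟨i, rfl⟩, ?_, ?_, by simp, rfl, rfl⟩⟩
    · simpa using (flipAt_ne i u).symm
    · intro x
      rw [inCube_iff (mem_singleton_self i)]
      simp [InCube, funext_iff]
  | succ m ih =>
    intro S F u v hS hF huv hp
    obtain ⟨d, hd, hdF⟩ : ∃ d ∈ S, (crossFaults (S.erase d) d u F).Nonempty ∨
        cubeFaults S u F = ∅ := by
      rcases (cubeFaults S u F).eq_empty_or_nonempty with h | ⟨e, he⟩
      · obtain ⟨d, hd⟩ := card_pos.1 (by omega : 0 < S.card)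
        exact ⟨d, hd, .inr h⟩
      · obtain ⟨heF, x, d, hx, hd, rfl⟩ := mem_filter.1 he
        refine ⟨d, hd, .inl ?_⟩
        rcases (inCube_iff hd).1 hx with hx | hx
        · exact ⟨_, mem_filter.2 ⟨heF, x, hx, rfl⟩⟩
        · refine ⟨_, mem_filter.2 ⟨heF, flipAt d x, ?_, (edge_flipAt d x).symm⟩⟩
          simpa using hx.flipAt_base
    have hcard := card_faults_add_le S d u F
    have hSd : (S.erase d).card = m + 1 := by rw [card_erase_of_mem hd]; omega
    have hpos := Nat.one_le_two_pow (n := m)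
    have hF₀ : (cubeFaults (S.erase d) u F).card ≤ m - 1 ∧
        (cubeFaults (S.erase d) (flipAt d u) F).card ≤ m - 1 := by
      rcases hdF with h | h
      · have := h.card_pos
        omega
      · have h0 := cubeFaults_erase_subset (c := u) (F := F) hd
        have h1 := cubeFaults_erase_subset (c := flipAt d u) (F := F) hd
        rw [cubeFaults_congr (inCube_self.flipAt hd), h] at h1
        rw [h] at h0
        simp [subset_empty.1 h0, subset_empty.1 h1]
    have path₀ : ∀ w, InCube (S.erase d) u w → qparity u ≠ qparity w →
        ∃ l, IsHamPath (S.erase d) u F u w l := fun w hw hpw =>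
      (ih _ _ _ _ hSd hF₀.1 hw hpw).imp fun l hl => hl.of_cubeFaults subset_rfl
    have path₁ : ∀ w z, InCube (S.erase d) (flipAt d u) w → InCube (S.erase d) (flipAt d u) z →
        qparity w ≠ qparity z → ∃ l, IsHamPath (S.erase d) w F w z l := fun w z hw hz hpw =>
      (ih _ _ _ _ hSd (by rw [cubeFaults_congr hw]; exact hF₀.2) (hw.symm.trans hz) hpw).imp
        fun l hl => hl.of_cubeFaults subset_rfl
    have hcross : (crossFaults (S.erase d) d u F).card ≤ m := by omega
    rcases (inCube_iff hd).1 huv with hv | hv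
    · obtain ⟨l, hl⟩ := path₀ v hv hp
      obtain ⟨l₁, a, b, l₂, rfl, ha, hb⟩ := exists_consecutive_healthy (notMem_erase d S) hl.nodup
        (fun x hx => (hl.mem x).1 hx) (F := F) (by
          have := two_mul_lt_two_pow_add_one (m + 1)
          rw [hl.len, hSd]; omega)
      have hab : Healthy F a b := by
        have := hl.chain
        rw [List.isChain_append_cons_cons] at this
        exact this.2.1
      have hac : InCube (S.erase d) u a := (hl.mem a).1 (by simp)
      have hbc : InCube (S.erase d) u b := (hl.mem b).1 (by simp)
      obtain ⟨k, hk⟩ := path₁ (flipAt d a) (flipAt d b) hac.flipAt_base hbc.flipAt_base (by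
        rw [qparity_flipAt, qparity_flipAt, hab.qparity_eq]
        generalize qparity a = t
        revert t; decide)
      have hkmem : ∀ x, x ∈ k ↔ InCube (S.erase d) (flipAt d u) x := fun x =>
        (hk.mem x).trans ⟨fun h => hac.flipAt_base.trans h, fun h => hac.flipAt_base.symm.trans h⟩
      refine ⟨(l₁ ++ [a]) ++ k ++ (b :: l₂), ⟨?_, ?_, ?_, ?_, ?_, ?_⟩⟩
      · have h := hl.chain
        rw [List.isChain_append_cons_cons] at h
        rw [List.isChain_append, List.isChain_append]
        refine ⟨⟨h.1, hk.chain, ?_⟩, h.2.2, ?_⟩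
        · simpa [hk.head] using ⟨⟨d, rfl⟩, ha⟩
        · simpa [hk.last, List.getLast?_append, List.getLast?_cons] using Healthy.symm ⟨⟨d, rfl⟩, hb⟩
      · have hperm : ((l₁ ++ [a]) ++ k ++ (b :: l₂)).Perm ((l₁ ++ a :: b :: l₂) ++ k) := by
          grind
        rw [hperm.nodup_iff]
        refine hl.nodup.append hk.nodup fun x hx hx' => ?_
        exact not_inCube_both ((hl.mem x).1 hx) ((hkmem x).1 hx')
      · intro x
        rw [inCube_iff hd, ← hl.mem, ← hkmem]
        simp only [List.mem_append, List.mem_cons, List.not_mem_nil]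
        tauto
      · have := hl.len
        have := hk.len
        have h2 : S.card = (S.erase d).card + 1 := by omega
        rw [h2, pow_succ]
        simp only [List.length_append, List.length_cons, List.length_nil] at *
        omega
      · have := hl.head
        rw [List.append_assoc, List.append_assoc]
        cases l₁ <;> simpa using this
      · have := hl.last
        simpa [List.getLast?_append, List.getLast?_cons] using this
    · obtain ⟨i, hi, hiF⟩ : ∃ i ∈ S.erase d, s(flipAt i u, flipAt d (flipAt i u)) ∉ F := by
        by_contra! h
        have := card_le_card_of_injOn (s := S.erase d) (t := F)
          (fun i => s(flipAt i u, flipAt d (flipAt i u))) h (by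
            intro i hi j hj hij
            obtain ⟨-, h | h⟩ := edge_eq_iff.1 hij
            · exact flipAt_left_injective _ h
            · have := congrFun h d
              rw [flipAt_apply_self, flipAt_apply_of_ne (ne_of_mem_erase hi).symm,
                flipAt_apply_of_ne (ne_of_mem_erase hj).symm] at this
              simp at this)
        omega
      have hw : InCube (S.erase d) u (flipAt i u) := inCube_self.flipAt hi
      obtain ⟨l, hl⟩ := path₀ (flipAt i u) hw (by
        rw [qparity_flipAt]
        generalize qparity u = t
        revert t; decide)
      obtain ⟨k, hk⟩ := path₁ (flipAt d (flipAt i u)) v hw.flipAt_base hv (by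
        rw [qparity_flipAt, qparity_flipAt]
        revert hp
        generalize qparity u = t, qparity v = t'
        revert t t'; decide)
      have hkmem : ∀ x, x ∈ k ↔ InCube (S.erase d) (flipAt d u) x := fun x =>
        (hk.mem x).trans ⟨fun h => hw.flipAt_base.trans h, fun h => hw.flipAt_base.symm.trans h⟩
      refine ⟨l ++ k, ⟨?_, ?_, ?_, ?_, ?_, ?_⟩⟩
      · refine List.isChain_append.2 ⟨hl.chain, hk.chain, ?_⟩
        simpa [hl.last, hk.head] using ⟨⟨d, rfl⟩, hiF⟩
      · refine hl.nodup.append hk.nodup fun x hx hx' => ?_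
        exact not_inCube_both ((hl.mem x).1 hx) ((hkmem x).1 hx')
      · intro x
        rw [inCube_iff hd, ← hl.mem, ← hkmem, List.mem_append]
      · rw [List.length_append, hl.len, hk.len, ← mul_two, ← pow_succ, hSd, hS]
      · simp [hl.head]
      · simp [hk.last, List.getLast?_append]

/-- A Hamiltonian path of one half of a subcube closes up through the other half. -/
lemma IsHamPath.exists_isHamCycle {m : ℕ} {a b : Fin n → Bool} (hd : d ∈ S) (hS : S.card = m + 2)
    (hl : IsHamPath (S.erase d) c F b a l) (ha : s(a, flipAt d a) ∉ F) (hb : s(b, flipAt d b) ∉ F)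
    (hab : qparity a ≠ qparity b)
    (hF : (cubeFaults (S.erase d) (flipAt d c) F).card ≤ m - 1) :
    ∃ k, IsHamCycle S c F k := by
  have hSd : (S.erase d).card = m + 1 := by rw [card_erase_of_mem hd]; omega
  have hac : InCube (S.erase d) c a := (hl.mem a).1 (List.mem_of_getLast? hl.last)
  have hbc : InCube (S.erase d) c b := (hl.mem b).1 (List.mem_of_head? hl.head)
  obtain ⟨k, hk⟩ := exists_isHamPath m (S.erase d) (cubeFaults (S.erase d) (flipAt d a) F)
    (flipAt d a) (flipAt d b) hSd (by rwa [cubeFaults_congr hac.flipAt_base]) (hac.flipAt_base.symm.trans hbc.flipAt_base) (by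
      rw [qparity_flipAt, qparity_flipAt]
      exact fun h => hab (add_right_cancel h))
  replace hk := hk.of_cubeFaults (F := F) subset_rfl
  have hkmem : ∀ x, x ∈ k ↔ InCube (S.erase d) (flipAt d c) x := fun x =>
    (hk.mem x).trans ⟨fun h => hac.flipAt_base.trans h, fun h => hac.flipAt_base.symm.trans h⟩
  refine ⟨l ++ k, ⟨?_, ?_, ?_, ?_, ?_⟩⟩
  · refine List.isChain_append.2 ⟨hl.chain, hk.chain, ?_⟩
    simpa [hl.last, hk.head] using ⟨⟨d, rfl⟩, ha⟩
  · refine hl.nodup.append hk.nodup fun x hx hx' => ?_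
    exact not_inCube_both ((hl.mem x).1 hx) ((hkmem x).1 hx')
  · intro x
    rw [inCube_iff hd, ← hl.mem, ← hkmem, List.mem_append]
  · rw [List.length_append, hl.len, hk.len, ← mul_two, ← pow_succ, hSd, hS]
  · simpa [hl.head, hk.last, List.getLast?_append] using Healthy.symm ⟨⟨d, rfl⟩, hb⟩

lemma isChain_ne_of_nodup {α : Type*} {l : List α} {a b : α} (hl : l.Nodup) (hlen : 3 ≤ l.length)
    (hb : l.head? = some b) (ha : l.getLast? = some a) :
    l.IsChain (fun x y => s(x, y) ≠ s(a, b)) := by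
  rw [List.isChain_iff_getElem]
  intro i hi h
  rw [List.head?_eq_getElem?, List.getElem?_eq_some_iff] at hb
  rw [List.getLast?_eq_getElem?, List.getElem?_eq_some_iff] at ha
  obtain ⟨hb0, hb⟩ := hb
  obtain ⟨ha0, ha⟩ := ha
  rcases Sym2.eq_iff.1 h with ⟨h1, h2⟩ | ⟨h1, h2⟩
  · have := (hl.getElem_inj_iff).1 (h1.trans ha.symm)
    omega
  · have := (hl.getElem_inj_iff).1 (h1.trans hb.symm)
    have := (hl.getElem_inj_iff).1 (h2.trans ha.symm)
    omega

lemma IsHamCycle.rotate {a b : Fin n → Bool} {l₁ l₂ : List (Fin n → Bool)}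
    (h : IsHamCycle S c F (l₁ ++ a :: b :: l₂)) :
    Healthy F a b ∧ IsHamPath S c F b a ((b :: l₂) ++ (l₁ ++ [a])) := by
  have hc := h.chain
  rw [List.isChain_append_cons_cons] at hc
  have hperm : ((b :: l₂) ++ (l₁ ++ [a])).Perm (l₁ ++ a :: b :: l₂) := by grind
  refine ⟨hc.2.1, ?_, ?_, ?_, ?_, by simp, by simp [List.getLast?_cons, List.getLast?_append]⟩
  · refine List.isChain_append.2 ⟨hc.2.2, hc.1, fun x hx y hy => h.close x ?_ y ?_⟩
    · simpa [List.getLast?_append, List.getLast?_cons] using hx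
    · cases l₁ <;> simpa using hy
  · rw [hperm.nodup_iff]; exact h.nodup
  · intro x; rw [hperm.mem_iff]; exact h.mem x
  · rw [hperm.length_eq]; exact h.len

lemma IsHamPath.of_not_healthy {a b : Fin n → Bool} (hS : 2 ≤ S.card)
    (h : IsHamPath S c F' b a l) (hab : Healthy F' a b) (hab' : ¬ Healthy F a b)
    (hF : ∀ e ∈ cubeFaults S c F, e ∉ F' → ∀ x ∈ e, s(x, flipAt d x) ∉ F)
    (hsub : ∀ e ∈ cubeFaults S c F, ∀ e' ∈ cubeFaults S c F, e ∉ F' → e' ∉ F' → e = e') :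
    IsHamPath S c F b a l ∧ s(a, flipAt d a) ∉ F ∧ s(b, flipAt d b) ∉ F := by
  have key : ∀ x ∈ l, ∀ y ∈ l, Healthy F' x y → ¬ Healthy F x y →
      s(x, y) ∈ cubeFaults S c F := by
    rintro x hx y hy ⟨⟨i, rfl⟩, h1⟩ h2
    refine mem_filter.2 ⟨by_contra fun h3 => h2 ⟨⟨i, rfl⟩, h3⟩, x, i, (h.mem x).1 hx, ?_, rfl⟩
    exact mem_of_inCube_flipAt ((h.mem _).1 hx) ((h.mem _).1 hy)
  have he := key a (List.mem_of_getLast? h.last) b (List.mem_of_head? h.head) hab hab'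
  refine ⟨{ h with chain := ?_ }, hF _ he hab.2 a (by simp), hF _ he hab.2 b (by simp)⟩
  have h4 : 2 ^ 2 ≤ l.length := h.len ▸ Nat.pow_le_pow_right (by norm_num) hS
  have hne := isChain_ne_of_nodup h.nodup (by omega) h.head h.last
  have hch := h.chain
  rw [List.isChain_iff_getElem] at hne hch ⊢
  intro i hi
  by_contra hxy
  have hxy' := key _ (List.getElem_mem _) _ (List.getElem_mem _) (hch i hi) hxy
  exact hne i hi (hsub _ hxy' _ he (hch i hi).2 hab.2)

/-- A Hamiltonian cycle avoiding all but possibly one of the faults of a subcube can be opened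
to a Hamiltonian path avoiding all of them, at two vertices where the edge in direction `d` is
not faulty. -/
lemma IsHamCycle.exists_isHamPath (hd : d ∉ S) (hS : 2 ≤ S.card) (h : IsHamCycle S c F' l)
    (hF : ∀ e ∈ cubeFaults S c F, e ∉ F' → ∀ x ∈ e, s(x, flipAt d x) ∉ F)
    (hsub : ∀ e ∈ cubeFaults S c F, ∀ e' ∈ cubeFaults S c F, e ∉ F' → e' ∉ F' → e = e')
    (hlen : 2 * (crossFaults S d c F).card + 1 < 2 ^ S.card) :
    ∃ a b k, IsHamPath S c F b a k ∧ s(a, flipAt d a) ∉ F ∧ s(b, flipAt d b) ∉ F ∧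
      qparity a ≠ qparity b := by
  have hpar : ∀ {G : Finset (Sym2 (Fin n → Bool))} {a b}, Healthy G a b →
      qparity a ≠ qparity b := fun {G a b} hab => by
    rw [hab.qparity_eq]
    generalize qparity a = t
    revert t; decide
  by_cases hc : l.IsChain (Healthy F)
  · by_cases hcl : ∀ x ∈ l.getLast?, ∀ y ∈ l.head?, Healthy F x y
    · have h' : IsHamCycle S c F l := { h with chain := hc, close := hcl }
      obtain ⟨l₁, a, b, l₂, rfl, ha, hb⟩ := exists_consecutive_healthy hd h.nodup
        (fun x hx => (h.mem x).1 hx) (by rwa [h.len])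
      exact ⟨a, b, _, h'.rotate.2, ha, hb, hpar h'.rotate.1⟩
    · push Not at hcl
      obtain ⟨a, ha, b, hb, hab⟩ := hcl
      have hp : IsHamPath S c F' b a l := { h with head := hb, last := ha }
      have hab' := h.close a ha b hb
      obtain ⟨h1, h2, h3⟩ := hp.of_not_healthy hS hab' hab hF hsub
      exact ⟨a, b, l, h1, h2, h3, hpar hab'⟩
  · obtain ⟨l₁, a, b, l₂, rfl, hab⟩ := exists_append_of_not_isChain hc
    obtain ⟨hab', hp⟩ := h.rotate
    obtain ⟨h1, h2, h3⟩ := hp.of_not_healthy hS hab' hab hF hsub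
    exact ⟨a, b, _, h1, h2, h3, hpar hab'⟩

lemma exists_flipAt_of_card_lt (hxy : x ≠ y)
    (h : F.card < (faultyDirs S F x).card + (faultyDirs S F y).card) :
    ∃ i ∈ faultyDirs S F x, i ∈ faultyDirs S F y ∧ y = flipAt i x := by
  have hcard : ∀ z, ((faultyDirs S F z).image fun i => s(z, flipAt i z)).card =
      (faultyDirs S F z).card := fun z => card_image_of_injective _ fun i j hij =>
    (edge_eq_iff.1 hij).1
  have hsub : ∀ z, (faultyDirs S F z).image (fun i => s(z, flipAt i z)) ⊆ F := fun z =>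
    image_subset_iff.2 fun i hi => (mem_filter.1 hi).2
  have hnd : ¬ Disjoint ((faultyDirs S F x).image fun i => s(x, flipAt i x))
      ((faultyDirs S F y).image fun i => s(y, flipAt i y)) := fun hd => by
    have := card_le_card (union_subset (hsub x) (hsub y))
    rw [card_union_of_disjoint hd, hcard, hcard] at this
    omega
  obtain ⟨e, he, he'⟩ := Finset.not_disjoint_iff.1 hnd
  obtain ⟨i, hi, rfl⟩ := mem_image.1 he
  obtain ⟨j, hj, hij⟩ := mem_image.1 he'
  obtain ⟨rfl, h | h⟩ := edge_eq_iff.1 hij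
  · exact absurd h.symm hxy
  · exact ⟨j, hi, hj, h⟩

/-- There is a splitting direction that is faulty at every vertex with many faults. -/
lemma exists_splitting_direction {m : ℕ} (hS : S.card = m + 4) (hF : F.card ≤ 2 * m + 3) :
    ∃ d ∈ S, (∀ x, InCube S c x → (faultyDirs S F x).card = m + 2 → d ∈ faultyDirs S F x) ∧
      ((∃ x, InCube S c x ∧ d ∈ faultyDirs S F x) ∨
        ∀ x, InCube S c x → faultyDirs S F x = ∅) := by
  by_cases hb : ∃ x, InCube S c x ∧ (faultyDirs S F x).card = m + 2
  · obtain ⟨x, hx, hxc⟩ := hb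
    by_cases hb' : ∃ y, InCube S c y ∧ (faultyDirs S F y).card = m + 2 ∧ x ≠ y
    · obtain ⟨y, hy, hyc, hxy⟩ := hb'
      obtain ⟨d, hdx, hdy, rfl⟩ := exists_flipAt_of_card_lt (F := F) (S := S) hxy (by omega)
      refine ⟨d, (mem_filter.1 hdx).1, fun z hz hzc => ?_, .inl ⟨x, hx, hdx⟩⟩
      by_cases hzx : x = z
      · exact hzx ▸ hdx
      by_cases hzy : flipAt d x = z
      · exact hzy ▸ hdy
      obtain ⟨i, -, -, h1⟩ := exists_flipAt_of_card_lt (F := F) (S := S) hzx (by omega)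
      obtain ⟨j, -, -, h2⟩ := exists_flipAt_of_card_lt (F := F) (S := S) hzy (by omega)
      have := congrArg qparity (h1.symm.trans h2)
      simp only [qparity_flipAt] at this
      generalize qparity x = t at this
      exact absurd this (by revert t; decide)
    · push Not at hb'
      obtain ⟨d, hd⟩ := card_pos.1 (by omega : 0 < (faultyDirs S F x).card)
      exact ⟨d, (mem_filter.1 hd).1, fun z hz hzc => hb' z hz hzc ▸ hd, .inl ⟨x, hx, hd⟩⟩
  · push Not at hb
    by_cases he : ∀ x, InCube S c x → faultyDirs S F x = ∅
    · obtain ⟨d, hd⟩ := card_pos.1 (by omega : 0 < S.card)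
      exact ⟨d, hd, fun x hx h => absurd h (hb x hx), .inr he⟩
    · push Not at he
      obtain ⟨x, hx, d, hd⟩ := he
      exact ⟨d, (mem_filter.1 hd).1, fun x hx h => absurd h (hb x hx), .inl ⟨x, hx, hd⟩⟩

/-- All but at most one of the faults in the larger half of a subcube can be selected so that
there are few of them and the remaining one meets no faulty edge in direction `d`. -/
lemma exists_cubeFaults_reduction {m : ℕ} (hd : d ∈ S) (hF : F.card ≤ 2 * m + 3)
    (hdeg : ∀ x, InCube S c x → (faultyDirs S F x).card ≤ m + 2)
    (hdF : (∃ x, InCube S c x ∧ d ∈ faultyDirs S F x) ∨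
      ∀ x, InCube S c x → faultyDirs S F x = ∅) :
    ∃ F' ⊆ F, F'.card ≤ 2 * m + 1 ∧
      (∀ e ∈ cubeFaults (S.erase d) c F, e ∉ F' → ∀ x ∈ e, s(x, flipAt d x) ∉ F) ∧
      (∀ e ∈ cubeFaults (S.erase d) c F, ∀ e' ∈ cubeFaults (S.erase d) c F,
        e ∉ F' → e' ∉ F' → e = e') := by
  have hcard := card_faults_add_le S d c F
  rcases le_or_gt (cubeFaults (S.erase d) c F).card (2 * m + 1) with h0 | h0
  · exact ⟨cubeFaults (S.erase d) c F, cubeFaults_subset, h0, fun e he he' => absurd he he',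
      fun e he e' _ he' => absurd he he'⟩
  obtain ⟨x₀, hx₀, hx₀F⟩ : ∃ x, InCube (S.erase d) c x ∧ s(x, flipAt d x) ∈ F := by
    rcases hdF with ⟨x, hx, hxd⟩ | h
    · rcases (inCube_iff hd).1 hx with hx | hx
      · exact ⟨x, hx, (mem_filter.1 hxd).2⟩
      · refine ⟨flipAt d x, by simpa using hx.flipAt_base, ?_⟩
        rw [edge_flipAt]
        exact (mem_filter.1 hxd).2
    · obtain ⟨e, he⟩ := card_pos.1 (by omega : 0 < (cubeFaults (S.erase d) c F).card)
      obtain ⟨heF, x, i, hx, hi, rfl⟩ := mem_filter.1 (cubeFaults_erase_subset hd he)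
      have : i ∈ faultyDirs S F x := mem_filter.2 ⟨hi, heF⟩
      simp [h x hx] at this
  have hx₀c : s(x₀, flipAt d x₀) ∈ crossFaults (S.erase d) d c F :=
    mem_filter.2 ⟨hx₀F, x₀, hx₀, rfl⟩
  have hpos := card_pos.2 ⟨_, hx₀c⟩
  have hone : (crossFaults (S.erase d) d c F).card ≤ 1 := by omega
  obtain ⟨e, he, hex⟩ : ∃ e ∈ cubeFaults (S.erase d) c F, x₀ ∉ e := by
    by_contra! h
    have hsub : cubeFaults (S.erase d) c F ⊆
        ((faultyDirs S F x₀).erase d).image fun i => s(x₀, flipAt i x₀) := fun e he => by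
      have hxe := h e he
      obtain ⟨heF, x, i, hx, hi, rfl⟩ := mem_filter.1 he
      have hi' : s(x₀, flipAt i x₀) = s(x, flipAt i x) := by
        rcases Sym2.mem_iff.1 hxe with rfl | rfl
        · rfl
        · exact edge_flipAt i x
      exact mem_image.2 ⟨i, mem_erase.2 ⟨ne_of_mem_erase hi, mem_filter.2
        ⟨mem_of_mem_erase hi, hi' ▸ heF⟩⟩, hi'⟩
    have h1 := (card_le_card hsub).trans card_image_le
    have hdx : d ∈ faultyDirs S F x₀ := mem_filter.2 ⟨hd, hx₀F⟩
    rw [card_erase_of_mem hdx] at h1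
    have h2 := hdeg x₀ ((inCube_iff hd).2 (.inl hx₀))
    omega
  have huniq : ∀ e' ∈ cubeFaults (S.erase d) c F,
      e' ∉ (cubeFaults (S.erase d) c F).erase e → e' = e := fun e' he' h =>
    by_contra fun hne => h (mem_erase.2 ⟨hne, he'⟩)
  refine ⟨(cubeFaults (S.erase d) c F).erase e,
    (erase_subset _ _).trans cubeFaults_subset, ?_, ?_, ?_⟩
  · rw [card_erase_of_mem he]
    omega
  · intro e' he' h x hx hxF
    obtain rfl := huniq e' he' h
    have hxc : InCube (S.erase d) c x := by
      obtain ⟨-, y, i, hy, hi, rfl⟩ := mem_filter.1 he'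
      rcases Sym2.mem_iff.1 hx with rfl | rfl
      · exact hy
      · exact hy.flipAt hi
    have := card_le_one.1 hone _ hx₀c _ (mem_filter.2 ⟨hxF, x, hxc, rfl⟩)
    obtain ⟨-, rfl | rfl⟩ := edge_eq_iff.1 this
    · exact hex hx
    · exact notMem_erase d S (mem_of_inCube_flipAt hxc hx₀)
  · intro e₁ h₁ e₂ h₂ h₁' h₂'
    rw [huniq e₁ h₁ h₁', huniq e₂ h₂ h₂']

/-- A subcube of dimension `m + 3` with at most `2 * m + 1` faults, in which every vertex is
incident to at least two healthy edges, has a Hamiltonian cycle avoiding the faults. -/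
theorem exists_isHamCycle (m : ℕ) : ∀ (S : Finset (Fin n)) (F : Finset (Sym2 (Fin n → Bool)))
    (c : Fin n → Bool), S.card = m + 3 → F.card ≤ 2 * m + 1 →
    (∀ x, InCube S c x → (faultyDirs S F x).card ≤ m + 1) → ∃ l, IsHamCycle S c F l := by
  induction m with
  | zero =>
    intro S F c hS hF hdeg
    obtain ⟨d, hd, hdF⟩ : ∃ d ∈ S, d ∉ faultyDirs S F c :=
      exists_mem_notMem_of_card_lt_card (by have := hdeg c inCube_self; omega)
    have hdF' : s(c, flipAt d c) ∉ F := fun h => hdF (mem_filter.2 ⟨hd, h⟩)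
    obtain ⟨l, hl⟩ := exists_isHamPath 2 S F c (flipAt d c) hS hF (inCube_self.flipAt hd) (by
      rw [qparity_flipAt]
      generalize qparity c = t
      revert t; decide)
    refine ⟨l, { hl with close := ?_ }⟩
    simpa [hl.head, hl.last] using Healthy.symm ⟨⟨d, rfl⟩, hdF'⟩
  | succ m ih =>
    intro S F c hS hF hdeg
    obtain ⟨d, hd, hbad, hdF⟩ := exists_splitting_direction (c := c) hS hF
    have hSd : (S.erase d).card = m + 3 := by rw [card_erase_of_mem hd]; omega
    have step : ∀ c', InCube S c c' →
        (cubeFaults (S.erase d) (flipAt d c') F).card ≤ (cubeFaults (S.erase d) c' F).card →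
        ∃ l, IsHamCycle S c' F l := by
      intro c' hc' hle
      have hcard := card_faults_add_le S d c' F
      obtain ⟨F', hF'F, hF', h1, h2⟩ := exists_cubeFaults_reduction (c := c') hd hF
        (fun x hx => hdeg x (hc'.trans hx))
        (hdF.imp (fun ⟨x, hx, h⟩ => ⟨x, hc'.symm.trans hx, h⟩) fun h x hx => h x (hc'.trans hx))
      obtain ⟨l, hl⟩ := ih (S.erase d) F' c' hSd hF' (fun x hx => by
        have hx' : InCube S c x := hc'.trans ((inCube_iff hd).2 (.inl hx))
        have hsub : faultyDirs (S.erase d) F' x ⊆ (faultyDirs S F x).erase d := fun i hi =>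
          mem_erase.2 ⟨ne_of_mem_erase (mem_filter.1 hi).1, mem_filter.2
            ⟨mem_of_mem_erase (mem_filter.1 hi).1, hF'F (mem_filter.1 hi).2⟩⟩
        have h3 := card_le_card hsub
        have h4 := hdeg x hx'
        by_cases h5 : (faultyDirs S F x).card = m + 2
        · rw [card_erase_of_mem (hbad x hx' h5)] at h3
          omega
        · have h6 := card_erase_le (s := faultyDirs S F x) (a := d)
          omega)
      obtain ⟨a, b, k, hk, ha, hb, hab⟩ := hl.exists_isHamPath (notMem_erase d S) (by omega) h1 h2
        (by
          have := Nat.lt_two_pow_self (n := m)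
          rw [hSd, pow_add]
          omega)
      exact hk.exists_isHamCycle (m := m + 2) hd hS ha hb hab (by omega)
    rcases le_total (cubeFaults (S.erase d) (flipAt d c) F).card
      (cubeFaults (S.erase d) c F).card with h | h
    · exact step c inCube_self h
    · have hc : InCube S c (flipAt d c) := inCube_self.flipAt hd
      obtain ⟨l, hl⟩ := step (flipAt d c) hc (by rwa [flipAt_flipAt])
      exact ⟨l, { hl with
        mem := fun x => (hl.mem x).trans ⟨fun h => hc.trans h, fun h => hc.symm.trans h⟩ }⟩

lemma Q_adj_iff : (Q n).Adj x y ↔ ∃ i, y = flipAt i x := by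
  have key : ∀ x y : Fin n → Bool, #{i | x i ≠ y i} = 1 ↔ ∃ i, y = flipAt i x := by
    intro x y
    rw [card_eq_one]
    refine exists_congr fun i => ⟨fun h => funext fun j => ?_, ?_⟩
    · have hj := Finset.ext_iff.1 h j
      simp only [mem_filter, mem_univ, true_and, mem_singleton] at hj
      by_cases hji : j = i
      · subst hji
        rw [flipAt_apply_self]
        have := hj.2 rfl
        revert this
        cases x j <;> cases y j <;> simp
      · rw [flipAt_apply_of_ne hji]
        exact (not_not.1 (mt hj.1 hji)).symm
    · rintro rfl
      ext j
      by_cases hji : j = i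
      · subst hji; simp [flipAt_apply_self]
      · simp [flipAt_apply_of_ne hji, hji]
  rw [Q, SimpleGraph.fromRel_adj, key, key]
  constructor
  · rintro ⟨-, h | ⟨i, rfl⟩⟩
    · exact h
    · exact ⟨i, (flipAt_flipAt i y).symm⟩
  · rintro ⟨i, rfl⟩
    exact ⟨(flipAt_ne i x).symm, .inl ⟨i, rfl⟩⟩

lemma deleteEdges_adj_iff : ((Q n).deleteEdges ↑F).Adj x y ↔ Healthy F x y := by
  rw [SimpleGraph.deleteEdges_adj, Q_adj_iff, Healthy, mem_coe]

lemma card_faultyDirs_add_faultyDeg : (faultyDirs univ F x).card + faultyDeg F x = n := by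
  have h : ((Q n).deleteEdges ↑F).neighborSet x =
      ((univ.filter fun i => s(x, flipAt i x) ∉ F).image fun i => flipAt i x : Finset _) := by
    ext y
    simp only [SimpleGraph.mem_neighborSet, deleteEdges_adj_iff, Healthy, coe_image, Set.mem_image,
      mem_coe, mem_filter, mem_univ, true_and]
    constructor
    · rintro ⟨⟨i, rfl⟩, h⟩
      exact ⟨i, h, rfl⟩
    · rintro ⟨i, h, rfl⟩
      exact ⟨⟨i, rfl⟩, h⟩
  rw [faultyDeg, h, Set.ncard_coe_finset, card_image_of_injective _ (flipAt_left_injective x),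
    faultyDirs, card_filter_add_card_filter_not, card_univ, Fintype.card_fin]

lemma exists_isHamiltonianCycle_of_list {α : Type*} [Fintype α] [DecidableEq α]
    {G : SimpleGraph α} {l : List α} (hc : l.IsChain G.Adj) (hl : l.Nodup)
    (hmem : ∀ x, x ∈ l) (hlen : 3 ≤ l.length)
    (hclose : ∀ x ∈ l.getLast?, ∀ y ∈ l.head?, G.Adj x y) :
    ∃ (v : α) (p : G.Walk v v), p.IsHamiltonianCycle := by
  have hne : l ≠ [] := by rintro rfl; simp at hlen
  have hadj := hclose _ (List.getLast?_eq_some_getLast hne) _ (List.head?_eq_some_head hne)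
  set p := SimpleGraph.Walk.ofSupport l hne hc with hp
  have hs : p.support = l := SimpleGraph.Walk.support_ofSupport hne hc
  have hpath : p.IsPath := SimpleGraph.Walk.IsPath.mk' (hs.symm ▸ hl)
  have hplen : p.length = l.length - 1 := SimpleGraph.Walk.length_ofSupport hne hc
  have hcard : l.length = Fintype.card α := by
    rw [← List.toFinset_card_of_nodup hl, ← Finset.card_univ]
    exact congrArg _ (Finset.eq_univ_iff_forall.2 fun x => List.mem_toFinset.2 (hmem x))
  refine ⟨_, .cons hadj p, ?_⟩
  rw [SimpleGraph.Walk.isHamiltonianCycle_iff_isCycle_and_length_eq,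
    SimpleGraph.Walk.cons_isCycle_iff]
  refine ⟨⟨hpath, fun h => ?_⟩, by rw [SimpleGraph.Walk.length_cons]; omega⟩
  have := hpath.length_eq_one_of_mem_edges (Sym2.eq_swap ▸ h)
  omega

end

theorem fault_tolerant_hamiltonian_cycle (n : ℕ) (hn : 3 ≤ n)
    (F : Finset (Sym2 (Fin n → Bool)))
    (hFE : (F : Set (Sym2 (Fin n → Bool))) ⊆ (Q n).edgeSet)
    (hF : F.card ≤ 2 * n - 5)
    (hdeg2 : ∀ v, 2 ≤ faultyDeg F v) :
    ∃ (v : Fin n → Bool) (p : ((Q n).deleteEdges ↑F).Walk v v),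
      p.IsHamiltonianCycle := by
  obtain ⟨l, hl⟩ := exists_isHamCycle (n - 3) univ F (fun _ => false)
    (by rw [card_univ, Fintype.card_fin]; omega) (by omega) (fun x _ => by
      have h1 := card_faultyDirs_add_faultyDeg (F := F) (x := x)
      have h2 := hdeg2 x
      omega)
  refine exists_isHamiltonianCycle_of_list (l := l)
    (hl.chain.imp fun _ _ h => deleteEdges_adj_iff.2 h) hl.nodup
    (fun x => (hl.mem x).2 fun i hi => absurd (mem_univ i) hi) ?_
    fun x hx y hy => deleteEdges_adj_iff.2 (hl.close x hx y hy)
  have : 2 ^ 3 ≤ 2 ^ n := Nat.pow_le_pow_right (by norm_num) hn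
  rw [hl.len, card_univ, Fintype.card_fin]
  omega
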